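/- Let 𝒯=(V,ℰ) be a leafless, locally finite rooted directed tree, q ≥ 1 a real number, S_{λ,q} the Dirichlet shift on ℓ²(V), and S'_{λ,q} = S_{λ,q}(S_{λ,q}*S_{λ,q})^{-1} its Cauchy dual. Then the spectral radius of S_{λ,q} and the spectral radius of S'_{λ,q} are both equal to 1. -/

import Mathlib

open scoped ENNReal InnerProductSpace
open ContinuousLinearMap

noncomputable section

/-- A (countably infinite) rooted directed tree. -/
structure DirTree (V : Type) where
  edge : V → V → Prop
  not_self : ∀ v, ¬ edge v v
  no_circuit : ∀ v, ¬ Relation.TransGen edge v v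
  connected : ∀ u v : V, Relation.ReflTransGen (fun a b => edge a b ∨ edge b a) u v
  uniq_parent : ∀ {u w v : V}, edge u v → edge w v → u = w
  root : V
  root_no_parent : ∀ u, ¬ edge u root
  root_uniq : ∀ v, (∀ u, ¬ edge u v) → v = root

namespace DirTree

variable {V : Type} (T : DirTree V)

/-- The set of children of a vertex. -/
def chi (v : V) : Set V := {u | T.edge v u}

/-- Leafless: every vertex has a child. -/
def Leafless : Prop := ∀ v : V, ∃ u, T.edge v u

/-- Locally finite: every vertex has finitely many children. -/
def LocFin : Prop := ∀ v : V, (T.chi v).Finite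

/-- The finset of children of a vertex (locally finite case). -/
def chiFin (hT : T.LocFin) (v : V) : Finset V := (hT v).toFinset

/-- Iterated child sets `Chi^⟨n⟩(W)`. -/
def chiIter (T : DirTree V) : ℕ → Set V → Set V
  | 0, W => W
  | n + 1, W => {u | ∃ v ∈ chiIter T n W, T.edge v u}

/-- The depth of a vertex: the unique `n` with `v ∈ Chi^⟨n⟩(root)`. -/
def depth (v : V) : ℕ := sInf {n | v ∈ T.chiIter n {T.root}}

/-- The parent map (junk value at the root). -/
def par (v : V) : V :=
  letI := Classical.propDecidable (∃ u, T.edge u v)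
  if h : ∃ u, T.edge u v then h.choose else v

end DirTree

/-- `ℓ²(V)`. -/
abbrev l2 (V : Type) := lp (fun _ : V => ℂ) 2

/-- The standard orthonormal basis vector `e_v` of `ℓ²(V)`. -/
def evec {V : Type} (v : V) : l2 V :=
  letI := Classical.decEq V
  lp.single 2 v 1

/-- The Pochhammer symbol `(x)_k = x (x+1) ⋯ (x+k-1)`. -/
def poch (x : ℝ) (k : ℕ) : ℝ := ∏ i ∈ Finset.range k, (x + i)

namespace DirTree

variable {V : Type} (T : DirTree V)

/-- The weight `λ_{u,q}` (for any child `u` of `v`). -/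
def wt (hT : T.LocFin) (q : ℝ) (v : V) : ℝ :=
  Real.sqrt (((T.depth v : ℝ) + q) / ((T.depth v : ℝ) + 1)) /
    Real.sqrt ((T.chiFin hT v).card)

/-- `S` is the Dirichlet shift with parameter `q` on `ℓ²(V)`:
`S e_v = ∑_{u ∈ Chi(v)} λ_{u,q} e_u`. -/
def IsDirichletShift (hT : T.LocFin) (q : ℝ) (S : l2 V →L[ℂ] l2 V) : Prop :=
  ∀ v : V, S (evec v) = ∑ u ∈ T.chiFin hT v, ((T.wt hT q v : ℝ) : ℂ) • evec u

end DirTree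

/-- The Cauchy dual `S (S*S)⁻¹` of a left-invertible operator. -/
def cauchyDual {V : Type} (S : l2 V →L[ℂ] l2 V) : l2 V →L[ℂ] l2 V :=
  S * Ring.inverse (ContinuousLinearMap.adjoint S * S)

/-! ### Products of sequences tending to one -/

section Sequences

open Filter Topology

/-- If `a → 1`, the products of `k` consecutive terms of `a` are `O(r ^ k)` for every `r > 1`,
uniformly in the starting point. -/
lemma exists_prod_range_add_le {a : ℕ → ℝ} (ha : ∀ n, 0 < a n) (hlim : Tendsto a atTop (𝓝 1))
    {r : ℝ} (hr : 1 < r) :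
    ∃ C : ℝ, 0 < C ∧ ∀ k n, ∏ i ∈ Finset.range k, a (n + i) ≤ C * r ^ k := by
  obtain ⟨N, hN⟩ := eventually_atTop.1 (hlim.eventually_le_const hr)
  have hr0 : 0 < r := one_pos.trans hr
  set b : ℕ → ℝ := fun n => max (a n / r) 1 with hb
  set P : ℕ → ℝ := fun n => ∏ i ∈ Finset.Ico n N, b i with hP
  have hb1 : ∀ n, 1 ≤ b n := fun n => le_max_right _ _
  have hab : ∀ n, a n ≤ r * b n := fun n => by
    have h : a n / r ≤ b n := le_max_left _ _
    rwa [div_le_iff₀' hr0] at h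
  have hP0 : ∀ n, 0 < P n := fun n => Finset.prod_pos fun i _ => one_pos.trans_le (hb1 i)
  have hstep : ∀ n, P (n + 1) ≤ P n ∧ a n * P (n + 1) ≤ r * P n := by
    intro n
    rcases lt_or_ge n N with h | h
    · have hPn : P n = b n * P (n + 1) := Finset.prod_eq_prod_Ico_succ_bot h b
      rw [hPn, ← mul_assoc]
      exact ⟨le_mul_of_one_le_left (hP0 _).le (hb1 n),
        mul_le_mul_of_nonneg_right (hab n) (hP0 _).le⟩
    · have h1 : P n = 1 := by simp [hP, Finset.Ico_eq_empty_of_le h]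
      have h2 : P (n + 1) = 1 := by
        simp [hP, Finset.Ico_eq_empty_of_le (h.trans n.le_succ)]
      rw [h1, h2]
      exact ⟨le_rfl, by simpa using hN n h⟩
  have hanti : Antitone P := antitone_nat_of_succ_le fun n => (hstep n).1
  have key : ∀ k n, ∏ i ∈ Finset.range k, a (n + i) ≤ P n * r ^ k := by
    intro k
    induction k with
    | zero =>
      intro n
      have h : ∏ _i ∈ Finset.Ico n N, (1 : ℝ) ≤ P n :=
        Finset.prod_le_prod (fun _ _ => zero_le_one) fun i _ => hb1 i
      simpa using h
    | succ k ih =>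
      intro n
      rw [Finset.prod_range_succ']
      have h : ∀ i, a (n + (i + 1)) = a (n + 1 + i) := fun i => by congr 1; omega
      simp only [h, add_zero]
      calc (∏ i ∈ Finset.range k, a (n + 1 + i)) * a n
          ≤ (P (n + 1) * r ^ k) * a n := mul_le_mul_of_nonneg_right (ih _) (ha n).le
        _ = (a n * P (n + 1)) * r ^ k := by ring
        _ ≤ (r * P n) * r ^ k := mul_le_mul_of_nonneg_right (hstep n).2 (by positivity)
        _ = P n * r ^ (k + 1) := by ring
  exact ⟨P 0, hP0 0, fun k n => (key k n).trans
    (mul_le_mul_of_nonneg_right (hanti n.zero_le) (by positivity))⟩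

/-- If `a → 1`, the product of the first `k` terms of `a` is at least `c * r⁻¹ ^ k`
for every `r > 1`. -/
lemma exists_le_prod_range {a : ℕ → ℝ} (ha : ∀ n, 0 < a n) (hlim : Tendsto a atTop (𝓝 1))
    {r : ℝ} (hr : 1 < r) :
    ∃ c : ℝ, 0 < c ∧ ∀ k, c * r⁻¹ ^ k ≤ ∏ i ∈ Finset.range k, a i := by
  have hinv : Tendsto (fun n => (a n)⁻¹) atTop (𝓝 1) := by
    simpa using hlim.inv₀ one_ne_zero
  obtain ⟨C, hC, h⟩ := exists_prod_range_add_le (fun n => inv_pos.2 (ha n)) hinv hr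
  refine ⟨C⁻¹, inv_pos.2 hC, fun k => ?_⟩
  have hk := h k 0
  simp only [zero_add, Finset.prod_inv_distrib] at hk
  rw [inv_pow, ← mul_inv]
  exact inv_le_of_inv_le₀ (Finset.prod_pos fun i _ => ha i) hk

lemma tendsto_mul_pow_rpow_one_div {C r : ℝ} (hC : 0 < C) (hr : 0 < r) :
    Tendsto (fun k : ℕ => (C * r ^ k) ^ (1 / k : ℝ)) atTop (𝓝 r) := by
  have h1 : Tendsto (fun k : ℕ => C ^ (1 / k : ℝ)) atTop (𝓝 1) := by
    have := (Real.continuousAt_const_rpow hC.ne').tendsto.comp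
      (tendsto_one_div_atTop_nhds_zero_nat (𝕜 := ℝ))
    simpa [Function.comp_def] using this
  have h2 : Tendsto (fun k : ℕ => C ^ (1 / k : ℝ) * r) atTop (𝓝 r) := by
    simpa using h1.mul_const r
  refine h2.congr' ?_
  filter_upwards [eventually_ne_atTop 0] with k hk
  rw [Real.mul_rpow hC.le (by positivity), one_div, Real.pow_rpow_inv_natCast hr.le hk]

/-- An element of a complex Banach algebra has spectral radius one if the norms of its powers
grow and decay slower than any geometric sequence. -/
lemma spectralRadius_eq_one_of_norm_pow {A : Type*} [NormedRing A] [NormedAlgebra ℂ A]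
    [CompleteSpace A] (x : A)
    (hu : ∀ r : ℝ, 1 < r → ∃ C : ℝ, 0 < C ∧ ∀ k : ℕ, ‖x ^ k‖ ≤ C * r ^ k)
    (hl : ∀ r : ℝ, 1 < r → ∃ c : ℝ, 0 < c ∧ ∀ k : ℕ, c * r⁻¹ ^ k ≤ ‖x ^ k‖) :
    spectralRadius ℂ x = 1 := by
  have hx := spectrum.pow_norm_pow_one_div_tendsto_nhds_spectralRadius x
  have hright : 𝓝[>] (1 : ℝ) ≤ 𝓝 1 := nhdsWithin_le_nhds
  apply le_antisymm
  · have h : ∀ r : ℝ, 1 < r → spectralRadius ℂ x ≤ ENNReal.ofReal r := by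
      intro r hr
      obtain ⟨C, hC, h⟩ := hu r hr
      refine le_of_tendsto_of_tendsto' hx
        (ENNReal.tendsto_ofReal (tendsto_mul_pow_rpow_one_div hC (one_pos.trans hr))) fun k => ?_
      exact ENNReal.ofReal_le_ofReal
        (Real.rpow_le_rpow (norm_nonneg _) (h k) (by positivity))
    have hlim : Tendsto (fun r : ℝ => ENNReal.ofReal r) (𝓝[>] 1) (𝓝 1) := by
      simpa using (ENNReal.continuous_ofReal.tendsto 1).mono_left hright
    exact ge_of_tendsto hlim (eventually_mem_nhdsWithin.mono fun r hr => h r hr)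
  · have h : ∀ r : ℝ, 1 < r → ENNReal.ofReal r⁻¹ ≤ spectralRadius ℂ x := by
      intro r hr
      have hr0 : 0 < r := one_pos.trans hr
      obtain ⟨c, hc, h⟩ := hl r hr
      refine le_of_tendsto_of_tendsto'
        (ENNReal.tendsto_ofReal (tendsto_mul_pow_rpow_one_div hc (inv_pos.2 hr0))) hx fun k => ?_
      exact ENNReal.ofReal_le_ofReal
        (Real.rpow_le_rpow (by positivity) (h k) (by positivity))
    have hlim : Tendsto (fun r : ℝ => ENNReal.ofReal r⁻¹) (𝓝[>] 1) (𝓝 1) := by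
      have h1 : Tendsto (fun r : ℝ => r⁻¹) (𝓝[>] 1) (𝓝 1) := by
        simpa using (tendsto_inv₀ (one_ne_zero (α := ℝ))).mono_left hright
      simpa using ENNReal.tendsto_ofReal h1
    exact le_of_tendsto hlim (eventually_mem_nhdsWithin.mono fun r hr => h r hr)

end Sequences

/-! ### The standard basis and diagonal operators -/

section Basis

variable {V : Type}

lemma evec_apply_self (v : V) : evec v v = 1 := by
  classical
  simp [evec]

lemma evec_apply_ne {v w : V} (h : w ≠ v) : evec v w = 0 := by
  classical
  simp [evec, h]

lemma norm_evec (v : V) : ‖evec v‖ = 1 := by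
  classical
  simp [evec, lp.norm_single]

lemma inner_evec_left (v : V) (f : l2 V) : ⟪evec v, f⟫_ℂ = f v := by
  classical
  simp [evec, lp.inner_single_left]

lemma hasSum_smul_evec (f : l2 V) : HasSum (fun v => f v • evec v) f := by
  let := Classical.decEq V
  convert lp.hasSum_single (p := 2) ENNReal.ofNat_ne_top f using 2 with v
  have h := lp.single_smul (𝕜 := ℂ) (E := fun _ : V => ℂ) 2 v (f v) (1 : ℂ)
  rw [smul_eq_mul, mul_one] at h
  exact h.symm

/-- An operator that is diagonal in the standard basis acts coordinatewise. -/
lemma apply_coord_of_diagonal {B : l2 V →L[ℂ] l2 V} {b : V → ℂ}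
    (hB : ∀ v, B (evec v) = b v • evec v) (f : l2 V) (w : V) : B f w = b w * f w := by
  have h := (innerSL ℂ (evec w) ∘L B).hasSum (hasSum_smul_evec f)
  have h' := hasSum_single (f := fun v => (innerSL ℂ (evec w) ∘L B) (f v • evec v)) w
    (fun v hv => by simp [hB, inner_evec_left, evec_apply_ne hv.symm])
  have hw := h.unique h'
  simp only [comp_apply, innerSL_apply_apply, map_smul, hB, inner_evec_left,
    evec_apply_self, smul_eq_mul, mul_one] at hw
  rw [hw, mul_comm]

lemma norm_le_of_diagonal {B : l2 V →L[ℂ] l2 V} {b : V → ℂ}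
    (hB : ∀ v, B (evec v) = b v • evec v) {C : ℝ} (hC : 0 ≤ C) (hb : ∀ v, ‖b v‖ ≤ C) :
    ‖B‖ ≤ C := by
  refine B.opNorm_le_bound hC fun f => ?_
  calc ‖B f‖ ≤ ‖(C : ℂ) • f‖ := lp.norm_mono two_ne_zero fun w => by
        rw [apply_coord_of_diagonal hB, norm_mul, lp.coeFn_smul, Pi.smul_apply, norm_smul,
          Complex.norm_real, Real.norm_of_nonneg hC]
        exact mul_le_mul_of_nonneg_right (hb w) (norm_nonneg _)
    _ = C * ‖f‖ := by rw [norm_smul, Complex.norm_real, Real.norm_of_nonneg hC]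

/-- A diagonal operator with diagonal entries in `[1, C]` is invertible. -/
lemma isUnit_of_diagonal {B : l2 V →L[ℂ] l2 V} {b : V → ℝ} {C : ℝ} (hC : 1 ≤ C)
    (hB : ∀ v, B (evec v) = (b v : ℂ) • evec v) (h1 : ∀ v, 1 ≤ b v) (h2 : ∀ v, b v ≤ C) :
    IsUnit B := by
  have hC0 : 0 < C := one_pos.trans_le hC
  have hdiag : ∀ v, (1 - (C : ℂ)⁻¹ • B) (evec v) = ((1 - C⁻¹ * b v : ℝ) : ℂ) • evec v := by
    intro v
    rw [sub_apply, one_apply_eq_self, smul_apply, hB, smul_smul]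
    push_cast
    rw [sub_smul, one_smul]
  have hnorm : ‖1 - (C : ℂ)⁻¹ • B‖ ≤ 1 - C⁻¹ := by
    refine norm_le_of_diagonal hdiag (sub_nonneg.2 (inv_le_one_of_one_le₀ hC)) fun v => ?_
    have hle : C⁻¹ * b v ≤ 1 := by
      rw [inv_mul_le_iff₀ hC0, mul_one]; exact h2 v
    have hge : C⁻¹ ≤ C⁻¹ * b v := le_mul_of_one_le_right (by positivity) (h1 v)
    rw [Complex.norm_real, Real.norm_of_nonneg (by linarith)]
    linarith
  have hlt : ‖1 - (C : ℂ)⁻¹ • B‖ < 1 := hnorm.trans_lt (by simpa using hC0)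
  have hu : IsUnit ((C : ℂ)⁻¹ • B) := by
    simpa using (Units.oneSub _ hlt).isUnit
  have hCc : (C : ℂ) ≠ 0 := by exact_mod_cast hC0.ne'
  exact (isUnit_smul_iff (Units.mk0 ((C : ℂ)⁻¹) (inv_ne_zero hCc)) B).1 hu

end Basis

/-! ### Depth in a rooted tree -/

namespace DirTree

variable {V : Type} (T : DirTree V)

lemma exists_mem_chiIter (v : V) : ∃ n, v ∈ T.chiIter n {T.root} := by
  induction T.connected T.root v with
  | refl => exact ⟨0, rfl⟩
  | @tail u w _ huw ih =>
    obtain ⟨n, hn⟩ := ih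
    rcases huw with h | h
    · exact ⟨n + 1, u, hn, h⟩
    · cases n with
      | zero =>
        obtain rfl : u = T.root := hn
        exact (T.root_no_parent _ h).elim
      | succ n =>
        obtain ⟨x, hx, hxu⟩ := hn
        exact ⟨n, T.uniq_parent hxu h ▸ hx⟩

lemma depth_root : T.depth T.root = 0 :=
  Nat.le_zero.1 (Nat.sInf_le (show T.root ∈ T.chiIter 0 {T.root} from rfl))

lemma depth_of_edge {v u : V} (h : T.edge v u) : T.depth u = T.depth v + 1 := by
  apply le_antisymm
  · exact Nat.sInf_le ⟨v, Nat.sInf_mem (T.exists_mem_chiIter v), h⟩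
  · have hu : u ∈ T.chiIter (T.depth u) {T.root} := Nat.sInf_mem (T.exists_mem_chiIter u)
    cases hd : T.depth u with
    | zero =>
      rw [hd] at hu
      obtain rfl : u = T.root := hu
      exact (T.root_no_parent _ h).elim
    | succ n =>
      rw [hd] at hu
      obtain ⟨x, hx, hxu⟩ := hu
      obtain rfl := T.uniq_parent hxu h
      exact Nat.succ_le_succ (Nat.sInf_le hx)

lemma mem_chiFin {hT : T.LocFin} {v u : V} : u ∈ T.chiFin hT v ↔ T.edge v u := by
  simp [chiFin, chi]

/-! ### Weighted shifts with depth-dependent moduli -/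

/-- If `A` maps each `e_v` into the span of the children of `v` and `A†A` is diagonal with
entries depending only on the depth, then so is `(A ^ k)† (A ^ k)`. -/
lemma adjoint_pow_mul_pow_apply_evec {A : l2 V →L[ℂ] l2 V} {a : ℕ → ℝ}
    (hspan : ∀ v, A (evec v) ∈ Submodule.span ℂ (evec '' T.chi v))
    (hA : ∀ v, (adjoint A * A) (evec v) = (a (T.depth v) : ℂ) • evec v) (k : ℕ) (v : V) :
    (adjoint (A ^ k) * A ^ k) (evec v) =
      ((∏ i ∈ Finset.range k, a (T.depth v + i) : ℝ) : ℂ) • evec v := by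
  induction k generalizing v with
  | zero => simp [← star_eq_adjoint]
  | succ k ih =>
    set B := adjoint (A ^ k) * A ^ k with hB
    have hBA : ∀ x ∈ Submodule.span ℂ (evec '' T.chi v),
        B x = ((∏ i ∈ Finset.range k, a (T.depth v + 1 + i) : ℝ) : ℂ) • x := by
      intro x hx
      induction hx using Submodule.span_induction with
      | mem x hx =>
        obtain ⟨u, hu, rfl⟩ := hx
        rw [ih u, T.depth_of_edge hu]
      | zero => simp
      | add x y _ _ hx hy => rw [map_add, hx, hy, smul_add]
      | smul c x _ hx => rw [map_smul, hx, smul_comm]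
    have hsplit : adjoint (A ^ (k + 1)) * A ^ (k + 1) = adjoint A * (B * A) := by
      simp only [hB, ← star_eq_adjoint, pow_succ, star_mul, mul_assoc]
    have hAv : adjoint A (A (evec v)) = (a (T.depth v) : ℂ) • evec v := hA v
    rw [hsplit, mul_apply_eq_comp, mul_apply_eq_comp, hBA _ (hspan v), map_smul, hAv, smul_smul,
      Finset.prod_range_succ']
    have h : ∀ i, T.depth v + 1 + i = T.depth v + (i + 1) := fun i => by omega
    rw [add_zero, Complex.ofReal_mul, Finset.prod_congr rfl fun i _ => congrArg a (h i)]

/-- A weighted shift whose moduli depend only on the depth and tend to one has spectral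
radius one. -/
lemma spectralRadius_eq_one {A : l2 V →L[ℂ] l2 V} {a : ℕ → ℝ}
    (hspan : ∀ v, A (evec v) ∈ Submodule.span ℂ (evec '' T.chi v))
    (hA : ∀ v, (adjoint A * A) (evec v) = (a (T.depth v) : ℂ) • evec v)
    (ha : ∀ n, 0 < a n) (hlim : Filter.Tendsto a Filter.atTop (nhds 1)) :
    spectralRadius ℂ A = 1 := by
  have hD := T.adjoint_pow_mul_pow_apply_evec hspan hA
  have hnorm : ∀ k, ‖A ^ k‖ ^ 2 = ‖adjoint (A ^ k) * A ^ k‖ := fun k => by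
    rw [sq]; exact ((A ^ k).norm_adjoint_comp_self).symm
  have hpos : ∀ k n, 0 < ∏ i ∈ Finset.range k, a (n + i) :=
    fun k n => Finset.prod_pos fun i _ => ha _
  apply spectralRadius_eq_one_of_norm_pow
  · intro r hr
    have hr0 : 0 < r := one_pos.trans hr
    obtain ⟨C, hC, h⟩ := exists_prod_range_add_le ha hlim (one_lt_pow₀ hr two_ne_zero)
    refine ⟨√C, Real.sqrt_pos.2 hC, fun k => ?_⟩
    refine (sq_le_sq₀ (by positivity) (by positivity)).1 ?_
    rw [hnorm, mul_pow, Real.sq_sqrt hC.le, ← pow_mul, mul_comm k 2, pow_mul]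
    refine norm_le_of_diagonal (hD k) (by positivity) fun v => ?_
    rw [Complex.norm_real, Real.norm_of_nonneg (hpos k _).le]
    exact h k _
  · intro r hr
    have hr0 : 0 < r := one_pos.trans hr
    obtain ⟨c, hc, h⟩ := exists_le_prod_range ha hlim (one_lt_pow₀ hr two_ne_zero)
    refine ⟨√c, Real.sqrt_pos.2 hc, fun k => ?_⟩
    refine (sq_le_sq₀ (by positivity) (norm_nonneg _)).1 ?_
    rw [hnorm, mul_pow, Real.sq_sqrt hc.le, ← pow_mul, mul_comm k 2, pow_mul, inv_pow]
    refine (h k).trans ?_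
    have hroot := (adjoint (A ^ k) * A ^ k).le_opNorm (evec T.root)
    rw [hD k, norm_smul, norm_evec, mul_one, mul_one, Complex.norm_real,
      Real.norm_of_nonneg (hpos k _).le, depth_root] at hroot
    simpa using hroot

/-! ### The Dirichlet shift -/

section DirichletShift

variable {T} {hT : T.LocFin} {q : ℝ} {S : l2 V →L[ℂ] l2 V}

lemma IsDirichletShift.apply_evec_mem_span (hS : T.IsDirichletShift hT q S) (v : V) :
    S (evec v) ∈ Submodule.span ℂ (evec '' T.chi v) := by
  rw [hS v]
  exact Submodule.sum_mem _ fun u hu => Submodule.smul_mem _ _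
    (Submodule.subset_span ⟨u, T.mem_chiFin.1 hu, rfl⟩)

lemma IsDirichletShift.adjoint_mul_self_apply_evec (hL : T.Leafless) (hq : 1 ≤ q)
    (hS : T.IsDirichletShift hT q S) (v : V) :
    (adjoint S * S) (evec v) =
      ((((T.depth v : ℝ) + q) / ((T.depth v : ℝ) + 1) : ℝ) : ℂ) • evec v := by
  have hadj : ∀ u, T.edge v u → adjoint S (evec u) = ((T.wt hT q v : ℝ) : ℂ) • evec v := by
    classical
    intro u hu
    ext w
    rw [← inner_evec_left, adjoint_inner_right, hS w, sum_inner]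
    simp only [inner_smul_left, inner_evec_left, Complex.conj_ofReal, lp.coeFn_smul,
      Pi.smul_apply, smul_eq_mul]
    by_cases hw : w = v
    · subst hw
      rw [Finset.sum_eq_single_of_mem u (T.mem_chiFin.2 hu)
        (fun x _ hx => by rw [evec_apply_ne hx, mul_zero]), evec_apply_self, evec_apply_self]
    · rw [evec_apply_ne hw, mul_zero]
      refine Finset.sum_eq_zero fun x hx => ?_
      have hxu : x ≠ u := by
        rintro rfl
        exact hw (T.uniq_parent (T.mem_chiFin.1 hx) hu)
      rw [evec_apply_ne hxu, mul_zero]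
  have hcard : (0 : ℝ) < (T.chiFin hT v).card := by
    obtain ⟨u, hu⟩ := hL v
    exact_mod_cast Finset.card_pos.2 ⟨u, T.mem_chiFin.2 hu⟩
  have hwt : ((T.chiFin hT v).card : ℝ) * (T.wt hT q v * T.wt hT q v) =
      ((T.depth v : ℝ) + q) / ((T.depth v : ℝ) + 1) := by
    rw [← sq, wt, div_pow, Real.sq_sqrt (by positivity), Real.sq_sqrt hcard.le,
      mul_div_cancel₀ _ hcard.ne']
  rw [mul_apply_eq_comp, hS v, map_sum, Finset.sum_congr rfl fun u hu => by
    rw [map_smul, hadj u (T.mem_chiFin.1 hu), smul_smul], Finset.sum_const, ← hwt,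
    ← Nat.cast_smul_eq_nsmul ℂ, smul_smul]
  push_cast
  rfl

end DirichletShift

end DirTree

lemma tendsto_add_div_add_one (q : ℝ) :
    Filter.Tendsto (fun n : ℕ => ((n : ℝ) + q) / ((n : ℝ) + 1)) Filter.atTop (nhds 1) := by
  have h := (tendsto_one_div_add_atTop_nhds_zero_nat (𝕜 := ℝ)).const_mul (q - 1)
  have h' := h.const_add 1
  rw [mul_zero, add_zero] at h'
  refine h'.congr fun n => ?_
  field_simp
  ring

theorem stmt_4 {V : Type} [Countable V] [Infinite V] (T : DirTree V)
    (hL : T.Leafless) (hT : T.LocFin) (q : ℝ) (hq : 1 ≤ q)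
    (S : l2 V →L[ℂ] l2 V) (hS : T.IsDirichletShift hT q S) :
    spectralRadius ℂ S = 1 ∧ spectralRadius ℂ (cauchyDual S) = 1 := by
  set a : ℕ → ℝ := fun n => ((n : ℝ) + q) / ((n : ℝ) + 1) with ha_def
  have ha1 : ∀ n, 1 ≤ a n := fun n => by
    rw [ha_def, one_le_div (by positivity)]; linarith
  have haq : ∀ n, a n ≤ q := fun n => by
    rw [ha_def, div_le_iff₀ (by positivity)]
    nlinarith [(Nat.cast_nonneg n : (0 : ℝ) ≤ n)]
  have ha0 : ∀ n, 0 < a n := fun n => one_pos.trans_le (ha1 n)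
  have hlim : Filter.Tendsto a Filter.atTop (nhds 1) := tendsto_add_div_add_one q
  have hspan := hS.apply_evec_mem_span
  have hD : ∀ v, (adjoint S * S) (evec v) = (a (T.depth v) : ℂ) • evec v :=
    hS.adjoint_mul_self_apply_evec hL hq
  refine ⟨T.spectralRadius_eq_one hspan hD ha0 hlim, ?_⟩
  obtain ⟨D, hDS⟩ := isUnit_of_diagonal hq hD (fun v => ha1 _) (fun v => haq _)
  set E : l2 V →L[ℂ] l2 V := ↑D⁻¹ with hE
  have hdual : cauchyDual S = S * E := by
    rw [cauchyDual, ← hDS, Ring.inverse_unit]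
  have hEv : ∀ v, E (evec v) = (((a (T.depth v))⁻¹ : ℝ) : ℂ) • evec v := by
    intro v
    have hne : (a (T.depth v) : ℂ) ≠ 0 := by exact_mod_cast (ha0 _).ne'
    have h1 : E ((D : l2 V →L[ℂ] l2 V) (evec v)) = evec v := by
      rw [← mul_apply_eq_comp, hE, D.inv_mul, one_apply_eq_self]
    rw [hDS, hD, map_smul] at h1
    rw [Complex.ofReal_inv, eq_inv_smul_iff₀ hne, h1]
  have hEstar : star E = E := by
    have hsa : star D = D := Units.ext (by
      rw [Units.coe_star, hDS, star_mul, ← star_eq_adjoint, star_star])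
    rw [hE, ← Units.coe_star, star_inv, hsa]
  have hdd : adjoint (cauchyDual S) * cauchyDual S = E := by
    rw [hdual, ← star_eq_adjoint, star_mul, hEstar, mul_assoc, ← mul_assoc (star S),
      star_eq_adjoint, ← hDS, hE, D.mul_inv, mul_one]
  refine T.spectralRadius_eq_one (a := fun n => (a n)⁻¹) (fun v => ?_) (fun v => ?_)
    (fun n => inv_pos.2 (ha0 n)) (by simpa using hlim.inv₀ one_ne_zero)
  · rw [hdual, mul_apply_eq_comp, hEv, map_smul]
    exact Submodule.smul_mem _ _ (hspan v)
  · rw [hdd, hEv]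

end
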